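/- There exist ε > 0 and a positive integer n_0 such that the following holds. Let H be a 3-graph on n > n_0 vertices and let s be an integer with 5n/18 − 1 ≤ s ≤ (n−2)/3. If ω(H) ≥ (1−ε)·3s, ν(H) ≤ s and e(H) > binom(3s+1, 3) + 3s(n − 3s − 1), then H is a subgraph of D^3_{n,s}, i.e., there is a vertex set U of size 3s+2 containing every edge of H. -/

import Mathlib

open Finset

/-- The edge set of the complete `k`-uniform hypergraph on vertex set `Fin n`. -/
def completeEdges (n k : ℕ) : Finset (Finset (Fin n)) :=
  Finset.powersetCard k Finset.univ

/-- A family of finsets is a matching if its members are pairwise disjoint. -/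
def IsMatchingFam {α : Type*} [DecidableEq α] (M : Finset (Finset α)) : Prop :=
  (M : Set (Finset α)).Pairwise Disjoint

section Matching

variable {α : Type*} [DecidableEq α]

theorem IsMatchingFam.union {M₁ M₂ : Finset (Finset α)} (h₁ : IsMatchingFam M₁)
    (h₂ : IsMatchingFam M₂) (h : ∀ e ∈ M₁, ∀ f ∈ M₂, Disjoint e f) :
    IsMatchingFam (M₁ ∪ M₂) := by
  intro e he f hf hne
  rw [mem_coe, mem_union] at he hf
  rcases he with he | he <;> rcases hf with hf | hf
  · exact h₁ he hf hne
  · exact h e he f hf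
  · exact (h f hf e he).symm
  · exact h₂ he hf hne

theorem card_union_of_disjoint_members {M₁ M₂ : Finset (Finset α)}
    (hne : ∀ e ∈ M₁, e.Nonempty) (h : ∀ e ∈ M₁, ∀ f ∈ M₂, Disjoint e f) :
    #(M₁ ∪ M₂) = #M₁ + #M₂ := by
  refine card_union_of_disjoint (disjoint_left.2 fun e h₁ h₂ => ?_)
  exact (hne e h₁).ne_empty (disjoint_self.1 (h e h₁ e h₂))

theorem isMatchingFam_singleton (e : Finset α) : IsMatchingFam {e} := by
  simp [IsMatchingFam]

theorem card_biUnion_id_le_three_mul {M : Finset (Finset α)} (h : ∀ e ∈ M, #e = 3) :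
    #(M.biUnion id) ≤ 3 * #M := by
  rw [mul_comm]
  exact card_biUnion_le_card_mul _ _ _ fun e he => (h e he).le

/-- A set with at least `3t` elements contains `t` pairwise disjoint triples. -/
theorem exists_disjoint_triples (t : ℕ) (S : Finset α) (hS : 3 * t ≤ #S) :
    ∃ M ⊆ powersetCard 3 S, IsMatchingFam M ∧ #M = t := by
  induction t generalizing S with
  | zero => exact ⟨∅, by simp, by simp [IsMatchingFam], rfl⟩
  | succ t ih =>
    obtain ⟨e, heS, he⟩ := exists_subset_card_eq (show 3 ≤ #S by omega)
    obtain ⟨M, hM, hMm, hMc⟩ := ih (S \ e) (by rw [card_sdiff_of_subset heS]; omega)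
    have hdis : ∀ f ∈ ({e} : Finset (Finset α)), ∀ g ∈ M, Disjoint f g := by
      intro f hf g hg
      rw [mem_singleton.1 hf]
      exact disjoint_sdiff.mono_right (mem_powersetCard.1 (hM hg)).1
    refine ⟨{e} ∪ M, ?_, (isMatchingFam_singleton e).union hMm hdis, ?_⟩
    · refine union_subset (by simp [mem_powersetCard, heS, he]) (hM.trans ?_)
      exact powersetCard_mono sdiff_subset
    · rw [card_union_of_disjoint_members _ hdis, hMc, card_singleton, add_comm]
      intro f hf
      rw [mem_singleton.1 hf, ← card_pos]
      omega

theorem exists_maximal_matching (F : Finset (Finset α)) (hF : ∀ e ∈ F, e.Nonempty) :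
    ∃ M ⊆ F, IsMatchingFam M ∧ ∀ e ∈ F, ¬ Disjoint e (M.biUnion id) := by
  classical
  obtain ⟨M, hM, hmax⟩ := exists_max_image (F.powerset.filter IsMatchingFam) card
    ⟨∅, by simp [IsMatchingFam]⟩
  rw [mem_filter, mem_powerset] at hM
  refine ⟨M, hM.1, hM.2, fun e he hd => ?_⟩
  rw [disjoint_biUnion_right] at hd
  have hdis : ∀ f ∈ ({e} : Finset (Finset α)), ∀ g ∈ M, Disjoint f g := by
    intro f hf g hg
    rw [mem_singleton.1 hf]
    exact hd g hg
  have hle := hmax ({e} ∪ M) (mem_filter.2 ⟨mem_powerset.2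
    (union_subset (singleton_subset_iff.2 he) hM.1),
    (isMatchingFam_singleton e).union hM.2 hdis⟩)
  rw [card_union_of_disjoint_members _ hdis, card_singleton] at hle
  · omega
  · intro f hf
    rw [mem_singleton.1 hf]
    exact hF e he

variable [Fintype α]

theorem card_filter_mem_mem_le {F : Finset (Finset α)} (hF : ∀ e ∈ F, #e = 3) {a c : α}
    (hac : a ≠ c) : #{e ∈ F | a ∈ e ∧ c ∈ e} ≤ Fintype.card α := by
  have hsub : {e ∈ F | a ∈ e ∧ c ∈ e} ⊆ univ.image fun z : α => ({a, c, z} : Finset α) := by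
    intro e he
    obtain ⟨heF, ha, hc⟩ := mem_filter.1 he
    have h1 : #((e.erase a).erase c) = 1 := by
      rw [card_erase_of_mem (mem_erase.2 ⟨hac.symm, hc⟩), card_erase_of_mem ha, hF e heF]
    obtain ⟨z, hz⟩ := card_eq_one.1 h1
    refine mem_image.2 ⟨z, mem_univ _, ?_⟩
    rw [← hz, insert_erase (mem_erase.2 ⟨hac.symm, hc⟩), insert_erase ha]
  exact (card_le_card hsub).trans card_image_le

theorem card_filter_mem_not_disjoint_le {F : Finset (Finset α)} (hF : ∀ e ∈ F, #e = 3)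
    {a : α} {C : Finset α} (haC : a ∉ C) :
    #{e ∈ F | a ∈ e ∧ ¬ Disjoint e C} ≤ #C * Fintype.card α := by
  have hsub : {e ∈ F | a ∈ e ∧ ¬ Disjoint e C} ⊆
      C.biUnion fun c => {e ∈ F | a ∈ e ∧ c ∈ e} := by
    intro e he
    obtain ⟨heF, ha, hd⟩ := mem_filter.1 he
    obtain ⟨c, hce, hcC⟩ := not_disjoint_iff.1 hd
    exact mem_biUnion.2 ⟨c, hcC, mem_filter.2 ⟨heF, ha, hce⟩⟩
  refine (card_le_card hsub).trans (card_biUnion_le_card_mul _ _ _ fun c hc => ?_)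
  exact card_filter_mem_mem_le hF fun h => haC (h ▸ hc)

/-- Vertices of large degree can be covered greedily by pairwise disjoint edges avoiding a
given set. -/
theorem exists_matching_cover {F : Finset (Finset α)} (hF : ∀ e ∈ F, #e = 3)
    (A B : Finset α) (hAB : Disjoint A B)
    (hdeg : ∀ a ∈ A, (#B + 3 * #A) * Fintype.card α < #{e ∈ F | a ∈ e}) :
    ∃ M ⊆ F, IsMatchingFam M ∧ #M = #A ∧ A ⊆ M.biUnion id ∧ Disjoint (M.biUnion id) B := by
  induction A using Finset.induction_on generalizing B with
  | empty => exact ⟨∅, by simp, by simp [IsMatchingFam], rfl, by simp, by simp⟩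
  | insert a A haA ih =>
    rw [disjoint_insert_left] at hAB
    rw [card_insert_of_notMem haA] at hdeg
    obtain ⟨e, he, heBA⟩ : ∃ e ∈ {e ∈ F | a ∈ e}, Disjoint e (B ∪ A) := by
      by_contra! hcon
      have h1 := card_filter_mem_not_disjoint_le hF (a := a) (C := B ∪ A)
        (by simp [hAB.1, haA])
      have h2 : {e ∈ F | a ∈ e} ⊆ {e ∈ F | a ∈ e ∧ ¬ Disjoint e (B ∪ A)} := fun e he =>
        mem_filter.2 ⟨(mem_filter.1 he).1, (mem_filter.1 he).2, hcon e he⟩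
      have h3 := (hdeg a (mem_insert_self _ _)).trans_le ((card_le_card h2).trans h1)
      have h4 := card_union_le B A
      exact absurd (lt_of_mul_lt_mul_right h3 (Nat.zero_le _)) (by omega)
    obtain ⟨heF, hae⟩ := mem_filter.1 he
    rw [disjoint_union_right] at heBA
    have hcard : #(B ∪ e) + 3 * #A ≤ #B + 3 * (#A + 1) := by
      have := card_union_le B e
      have := hF e heF
      omega
    obtain ⟨M, hMF, hMm, hMc, hAM, hMB⟩ := ih (B ∪ e)
      (disjoint_union_right.2 ⟨hAB.2, heBA.2.symm⟩)
      fun b hb => (Nat.mul_le_mul_right _ hcard).trans_lt (hdeg b (mem_insert_of_mem hb))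
    rw [disjoint_union_right] at hMB
    have hdis : ∀ f ∈ ({e} : Finset (Finset α)), ∀ g ∈ M, Disjoint f g := by
      intro f hf g hg
      rw [mem_singleton.1 hf]
      exact ((disjoint_biUnion_left _ _ _).1 hMB.2 g hg).symm
    refine ⟨{e} ∪ M, union_subset (singleton_subset_iff.2 heF) hMF,
      (isMatchingFam_singleton e).union hMm hdis, ?_, ?_, ?_⟩
    · rw [card_union_of_disjoint_members _ hdis, hMc, card_singleton,
        card_insert_of_notMem haA, add_comm]
      intro f hf
      rw [mem_singleton.1 hf]
      exact ⟨a, hae⟩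
    · rw [union_biUnion, singleton_biUnion]
      exact insert_subset (mem_union_left _ hae) (hAM.trans subset_union_right)
    · rw [union_biUnion, singleton_biUnion]
      exact disjoint_union_left.2 ⟨heBA.1, hMB.1⟩

/-- A matching `M` extends to a matching using nearly all vertices of `K ∪ R` left over by `M`,
when `K` is a clique and the vertices of `R` have large degree. -/
theorem exists_matching_extension {H : Finset (Finset α)} (hH : ∀ e ∈ H, #e = 3)
    {K R : Finset α} (hK : powersetCard 3 K ⊆ H) {M : Finset (Finset α)} (hM : M ⊆ H)
    (hMm : IsMatchingFam M)
    (hR : ∀ r ∈ R, (3 * #M + 3 * #R) * Fintype.card α < #{e ∈ H | r ∈ e}) {t : ℕ}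
    (ht : #(M.biUnion id ∩ (K ∪ R)) + 3 * t ≤ #(K ∪ R)) :
    ∃ M' ⊆ H, IsMatchingFam M' ∧ #M + t ≤ #M' := by
  have hMB := card_biUnion_id_le_three_mul fun e he => hH e (hM he)
  have hAR := card_le_card (sdiff_subset (s := R) (t := M.biUnion id))
  obtain ⟨N, hNH, hNm, hNc, hAN, hNM⟩ := exists_matching_cover hH (R \ M.biUnion id)
    (M.biUnion id) sdiff_disjoint fun a ha =>
      (Nat.mul_le_mul_right _ (by omega)).trans_lt (hR a (sdiff_subset ha))
  have hNB := card_biUnion_id_le_three_mul fun e he => hH e (hNH he)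
  have hMN : ∀ e ∈ M, ∀ f ∈ N, Disjoint e f := fun e he f hf =>
    (hNM.symm.mono_left (subset_biUnion_of_mem id he)).mono_right (subset_biUnion_of_mem id hf)
  set S := ((K ∪ R) \ M.biUnion id) \ N.biUnion id with hS
  have hSK : S ⊆ K := by
    intro x hx
    simp only [hS, mem_sdiff, mem_union] at hx
    rcases hx.1.1 with h | h
    · exact h
    · exact absurd (hAN (mem_sdiff.2 ⟨h, hx.1.2⟩)) hx.2
  have hScard : 3 * (t - #N) ≤ #S := by
    have h1 := le_card_sdiff (N.biUnion id) ((K ∪ R) \ M.biUnion id)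
    have h2 := card_sdiff_add_card_inter (K ∪ R) (M.biUnion id)
    rw [inter_comm] at h2
    rw [← hS] at h1
    omega
  obtain ⟨P, hPS, hPm, hPc⟩ := exists_disjoint_triples (t - #N) S hScard
  have hMNP : ∀ e ∈ M ∪ N, ∀ f ∈ P, Disjoint e f := by
    intro e he f hf
    have hfS := (mem_powersetCard.1 (hPS hf)).1
    rcases mem_union.1 he with he | he
    · exact ((disjoint_sdiff.mono_right sdiff_subset).mono_left
        (subset_biUnion_of_mem id he)).mono_right hfS
    · exact (disjoint_sdiff.mono_left (subset_biUnion_of_mem id he)).mono_right hfS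
  have hne : ∀ e ∈ H, e.Nonempty := fun e he => card_pos.1 (by rw [hH e he]; norm_num)
  refine ⟨M ∪ N ∪ P, union_subset (union_subset hM hNH)
    ((hPS.trans (powersetCard_mono hSK)).trans hK), (hMm.union hNm hMN).union hPm hMNP, ?_⟩
  rw [card_union_of_disjoint_members (fun e he => hne e (union_subset hM hNH he)) hMNP,
    card_union_of_disjoint_members (fun e he => hne e (hM he)) hMN]
  omega

theorem card_filter_mem_not_subset_le {F : Finset (Finset α)} (hF : ∀ e ∈ F, #e = 3)
    {K : Finset α} (hFK : ∀ e ∈ F, ¬ e ⊆ K) {z : α} (hz : z ∈ K) :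
    #{e ∈ F | z ∈ e} ≤ (Fintype.card α).choose 2 - (#K).choose 2 := by
  have hcard : #(powersetCard 2 (univ : Finset α) \ powersetCard 2 K) =
      (Fintype.card α).choose 2 - (#K).choose 2 := by
    rw [card_sdiff_of_subset (powersetCard_mono (subset_univ K)), card_powersetCard,
      card_powersetCard, card_univ]
  rw [← hcard]
  refine card_le_card_of_injOn (fun e => e.erase z) ?_ ?_
  · intro e he
    obtain ⟨heF, hze⟩ := mem_filter.1 he
    refine mem_coe.2 (mem_sdiff.2 ⟨mem_powersetCard.2 ⟨subset_univ _, ?_⟩, fun h => ?_⟩)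
    · rw [card_erase_of_mem hze, hF e heF]
    · apply hFK e heF
      rw [← insert_erase hze]
      exact insert_subset hz (mem_powersetCard.1 h).1
  · intro e he f hf hef
    rw [← insert_erase (mem_filter.1 he).2, ← insert_erase (mem_filter.1 hf).2]
    exact congrArg (insert z) hef

/-- If vertices outside `K` have small degree and the edges not inside `K` have no matching with
more than `d` edges, then few edges are not inside `K`. -/
theorem card_le_of_matching_le {F : Finset (Finset α)} (hF : ∀ e ∈ F, #e = 3)
    {K : Finset α} (hFK : ∀ e ∈ F, ¬ e ⊆ K) {d D : ℕ}
    (hD : 3 * (d + 1) * Fintype.card α ≤ D)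
    (hout : ∀ z ∉ K, #{e ∈ F | z ∈ e} ≤ D)
    (hd : ∀ M ⊆ F, IsMatchingFam M → #M ≤ d) :
    #F ≤ d * (3 * D + ((Fintype.card α).choose 2 - (#K).choose 2)) := by
  set X := (Fintype.card α).choose 2 - (#K).choose 2
  obtain ⟨M, hMF, hMm, hmax⟩ := exists_maximal_matching F fun e he =>
    card_pos.1 (by rw [hF e he]; norm_num)
  set T := M.biUnion id
  have hT : #T ≤ 3 * d := (card_biUnion_id_le_three_mul fun e he => hF e (hMF he)).trans
    (Nat.mul_le_mul_left _ (hd M hMF hMm))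
  set A := {z ∈ T | D < #{e ∈ F | z ∈ e}}
  have hA : #A ≤ d := by
    by_contra! hlt
    obtain ⟨A', hA', hA'c⟩ := exists_subset_card_eq (show d + 1 ≤ #A from hlt)
    obtain ⟨N, hNF, hNm, hNc, -⟩ := exists_matching_cover hF A' ∅ (disjoint_empty_right _)
      fun a ha => by
        rw [hA'c, card_empty, zero_add]
        exact hD.trans_lt (mem_filter.1 (hA' ha)).2
    have := hd N hNF hNm
    omega
  have hsub : F ⊆ T.biUnion fun z => {e ∈ F | z ∈ e} := by
    intro e he
    obtain ⟨z, hze, hzT⟩ := not_disjoint_iff.1 (hmax e he)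
    exact mem_biUnion.2 ⟨z, hzT, mem_filter.2 ⟨he, hze⟩⟩
  have hz : ∀ z ∈ T, #{e ∈ F | z ∈ e} ≤ D + if D < #{e ∈ F | z ∈ e} then X else 0 := by
    intro z _
    split_ifs with h
    · by_cases hzK : z ∈ K
      · exact (card_filter_mem_not_subset_le hF hFK hzK).trans (Nat.le_add_left _ _)
      · exact absurd (hout z hzK) (not_le.2 h)
    · omega
  calc #F ≤ ∑ z ∈ T, #{e ∈ F | z ∈ e} := (card_le_card hsub).trans card_biUnion_le
    _ ≤ ∑ z ∈ T, (D + if D < #{e ∈ F | z ∈ e} then X else 0) := sum_le_sum hz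
    _ = #T * D + #A * X := by
      rw [sum_add_distrib, sum_const, smul_eq_mul, ← sum_filter, sum_const, smul_eq_mul]
    _ ≤ 3 * d * D + d * X := by gcongr
    _ = d * (3 * D + X) := by ring

end Matching

section CrossIntersecting

variable {α : Type*} [DecidableEq α] {K : Finset α} {G G' : Finset (Finset α)}

theorem card_image_pair_erase_le {x : α} (hx : x ∈ K) :
    #((K.erase x).image fun z => ({x, z} : Finset α)) ≤ #K - 1 :=
  card_image_le.trans (card_erase_of_mem hx).le

theorem mem_image_pair_erase {x : α} {e : Finset α} (he : e ∈ powersetCard 2 K) (hxe : x ∈ e) :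
    e ∈ (K.erase x).image fun z => ({x, z} : Finset α) := by
  obtain ⟨heK, hec⟩ := mem_powersetCard.1 he
  obtain ⟨z, hz⟩ := card_eq_one.1 (show #(e.erase x) = 1 by rw [card_erase_of_mem hxe, hec])
  have hze : z ∈ e.erase x := by simp [hz]
  refine mem_image.2 ⟨z, erase_subset_erase x heK hze, ?_⟩
  rw [← hz, insert_erase hxe]

theorem card_add_three_le_of_meets_pair (hG : G ⊆ powersetCard 2 K) {f : Finset α}
    (hf : f ∈ powersetCard 2 K) (h : ∀ e ∈ G, ¬ Disjoint e f) : #G + 3 ≤ 2 * #K := by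
  obtain ⟨hfK, hfc⟩ := mem_powersetCard.1 hf
  obtain ⟨x, y, hxy, rfl⟩ := card_eq_two.1 hfc
  have hx : x ∈ K := hfK (by simp)
  have hy : y ∈ K := hfK (by simp)
  have hsub : G ⊆ ((K.erase x).image fun z => ({x, z} : Finset α)) ∪
      (((K.erase y).image fun z => ({y, z} : Finset α)).erase {x, y}) := by
    intro e he
    rw [mem_union]
    by_cases hxe : x ∈ e
    · exact Or.inl (mem_image_pair_erase (hG he) hxe)
    · have hye : y ∈ e := by
        have := h e he
        simp only [disjoint_insert_right, disjoint_singleton_right] at this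
        tauto
      refine Or.inr (mem_erase.2 ⟨?_, mem_image_pair_erase (hG he) hye⟩)
      rintro rfl
      simp at hxe
  have h1 := (card_le_card hsub).trans (card_union_le _ _)
  have h2 : #(((K.erase y).image fun z => ({y, z} : Finset α)).erase {x, y}) ≤ #K - 1 - 1 := by
    rw [card_erase_of_mem (mem_image_pair_erase hf (by simp))]
    exact Nat.sub_le_sub_right (card_image_pair_erase_le hy) 1
  have h3 := card_image_pair_erase_le hx
  have h4 : 2 ≤ #K := hfc ▸ card_le_card hfK
  omega

theorem card_le_four_of_meets_disjoint_pairs (hG : ∀ e ∈ G, #e = 2) {f g : Finset α}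
    (hf : #f = 2) (hg : #g = 2) (hfg : Disjoint f g) (hGf : ∀ e ∈ G, ¬ Disjoint e f)
    (hGg : ∀ e ∈ G, ¬ Disjoint e g) : #G ≤ 4 := by
  have hsub : G ⊆ (f ×ˢ g).image fun p => ({p.1, p.2} : Finset α) := by
    intro e he
    obtain ⟨x, hxe, hxf⟩ := not_disjoint_iff.1 (hGf e he)
    obtain ⟨y, hye, hyg⟩ := not_disjoint_iff.1 (hGg e he)
    have hxy : x ≠ y := fun h => disjoint_left.1 hfg hxf (h ▸ hyg)
    refine mem_image.2 ⟨(x, y), mem_product.2 ⟨hxf, hyg⟩, ?_⟩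
    refine eq_of_subset_of_card_le (by simp [insert_subset_iff, hxe, hye]) ?_
    rw [hG e he, card_pair hxy]
  calc #G ≤ #(f ×ˢ g) := (card_le_card hsub).trans card_image_le
    _ = 4 := by rw [card_product, hf, hg]

/-- Two distinct intersecting pairs have the form `{x, a}` and `{x, b}`. -/
theorem exists_eq_pair_of_not_disjoint {f g : Finset α} (hf : #f = 2) (hg : #g = 2)
    (hne : f ≠ g) (h : ¬ Disjoint f g) :
    ∃ x a b, x ≠ a ∧ x ≠ b ∧ a ≠ b ∧ f = {x, a} ∧ g = {x, b} := by
  obtain ⟨x, hxf, hxg⟩ := not_disjoint_iff.1 h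
  obtain ⟨a, ha⟩ := card_eq_one.1 (show #(f.erase x) = 1 by rw [card_erase_of_mem hxf, hf])
  obtain ⟨b, hb⟩ := card_eq_one.1 (show #(g.erase x) = 1 by rw [card_erase_of_mem hxg, hg])
  have hfa : f = {x, a} := by rw [← ha, insert_erase hxf]
  have hgb : g = {x, b} := by rw [← hb, insert_erase hxg]
  have hxa : x ≠ a := by rintro rfl; simp [hfa] at hf
  have hxb : x ≠ b := by rintro rfl; simp [hgb] at hg
  exact ⟨x, a, b, hxa, hxb, fun hab => hne (by rw [hfa, hgb, hab]), hfa, hgb⟩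

theorem mem_or_eq_pair_of_meets {x a b : α} {e : Finset α} (he : #e = 2) (hab : a ≠ b)
    (h1 : ¬ Disjoint e {x, a}) (h2 : ¬ Disjoint e {x, b}) : x ∈ e ∨ e = {a, b} := by
  simp only [disjoint_insert_right, disjoint_singleton_right] at h1 h2
  by_cases hx : x ∈ e
  · exact Or.inl hx
  · refine Or.inr (eq_of_subset_of_card_le ?_ ?_).symm
    · exact insert_subset (by tauto) (singleton_subset_iff.2 (by tauto))
    · rw [he, card_pair hab]

theorem card_le_of_meets_two_pairs (hK : 4 ≤ #K) (hG : G ⊆ powersetCard 2 K) {f g : Finset α}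
    (hf : f ∈ powersetCard 2 K) (hg : g ∈ powersetCard 2 K) (hne : f ≠ g)
    (hGf : ∀ e ∈ G, ¬ Disjoint e f) (hGg : ∀ e ∈ G, ¬ Disjoint e g) : #G ≤ #K := by
  have hG2 : ∀ e ∈ G, #e = 2 := fun e he => (mem_powersetCard.1 (hG he)).2
  have hf2 := (mem_powersetCard.1 hf).2
  have hg2 := (mem_powersetCard.1 hg).2
  by_cases hd : Disjoint f g
  · exact (card_le_four_of_meets_disjoint_pairs hG2 hf2 hg2 hd hGf hGg).trans hK
  obtain ⟨x, a, b, hxa, hxb, hab, rfl, rfl⟩ := exists_eq_pair_of_not_disjoint hf2 hg2 hne hd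
  have hx : x ∈ K := (mem_powersetCard.1 hf).1 (by simp)
  have hsub : G ⊆ insert {a, b} ((K.erase x).image fun z => ({x, z} : Finset α)) := by
    intro e he
    rcases mem_or_eq_pair_of_meets (hG2 e he) hab (hGf e he) (hGg e he) with h | h
    · exact mem_insert_of_mem (mem_image_pair_erase (hG he) h)
    · exact mem_insert.2 (Or.inl h)
  have h1 := (card_le_card hsub).trans (card_insert_le _ _)
  have h2 := card_image_pair_erase_le hx
  omega

theorem card_lt_of_meets_three_pairs (hK : 5 ≤ #K) (hG : G ⊆ powersetCard 2 K)
    {f g h : Finset α} (hf : f ∈ powersetCard 2 K) (hg : g ∈ powersetCard 2 K)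
    (hh : h ∈ powersetCard 2 K) (hfg : f ≠ g) (hfh : f ≠ h) (hgh : g ≠ h)
    (hGf : ∀ e ∈ G, ¬ Disjoint e f) (hGg : ∀ e ∈ G, ¬ Disjoint e g)
    (hGh : ∀ e ∈ G, ¬ Disjoint e h) : #G < #K := by
  have hG2 : ∀ e ∈ G, #e = 2 := fun e he => (mem_powersetCard.1 (hG he)).2
  have hf2 := (mem_powersetCard.1 hf).2
  have hg2 := (mem_powersetCard.1 hg).2
  have hh2 := (mem_powersetCard.1 hh).2
  by_cases hd : Disjoint f g
  · exact (card_le_four_of_meets_disjoint_pairs hG2 hf2 hg2 hd hGf hGg).trans_lt hK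
  obtain ⟨x, a, b, hxa, hxb, hab, rfl, rfl⟩ := exists_eq_pair_of_not_disjoint hf2 hg2 hfg hd
  have hx : x ∈ K := (mem_powersetCard.1 hf).1 (by simp)
  have hmem := fun e he => mem_or_eq_pair_of_meets (hG2 e he) hab (hGf e he) (hGg e he)
  by_cases hxh : x ∈ h
  · have hsub : G ⊆ (K.erase x).image fun z => ({x, z} : Finset α) := by
      intro e he
      rcases hmem e he with hxe | rfl
      · exact mem_image_pair_erase (hG he) hxe
      · exfalso
        have hnd := hGh _ he
        simp only [disjoint_insert_left, disjoint_singleton_left] at hnd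
        have hsubset : ({x, a} : Finset α) ⊆ h ∨ ({x, b} : Finset α) ⊆ h := by
          simp only [insert_subset_iff, singleton_subset_iff]
          tauto
        rcases hsubset with hs | hs
        · exact hfh (eq_of_subset_of_card_le hs (by rw [hf2, hh2]))
        · exact hgh (eq_of_subset_of_card_le hs (by rw [hg2, hh2]))
    have h1 := card_le_card hsub
    have h2 := card_image_pair_erase_le hx
    omega
  · have hsub : G ⊆ insert {a, b} (h.image fun z => ({x, z} : Finset α)) := by
      intro e he
      rcases hmem e he with hxe | hab'
      · obtain ⟨z, hze, hzh⟩ := not_disjoint_iff.1 (hGh e he)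
        have hxz : x ≠ z := fun hxz => hxh (hxz ▸ hzh)
        refine mem_insert_of_mem (mem_image.2 ⟨z, hzh, ?_⟩)
        refine eq_of_subset_of_card_le (by simp [insert_subset_iff, hxe, hze]) ?_
        rw [hG2 e he, card_pair hxz]
      · exact mem_insert.2 (Or.inl hab')
    have h1 := (card_le_card hsub).trans (card_insert_le _ _)
    have h2 : #(h.image fun z => ({x, z} : Finset α)) ≤ 2 := card_image_le.trans hh2.le
    omega

/-- Nonempty cross-intersecting graphs on `m` vertices have at most `2m - 2` edges in total. -/
theorem card_add_card_le_of_cross_intersecting (hK : 5 ≤ #K) (hG : G ⊆ powersetCard 2 K)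
    (hG' : G' ⊆ powersetCard 2 K) (hne : G.Nonempty) (hne' : G'.Nonempty)
    (h : ∀ e ∈ G, ∀ f ∈ G', ¬ Disjoint e f) : #G + #G' + 2 ≤ 2 * #K := by
  wlog hle : #G' ≤ #G generalizing G G'
  · rw [add_comm #G]
    exact this hG' hG hne' hne (fun e he f hf hd => h f hf e he hd.symm) (by omega)
  have hpos := card_pos.2 hne'
  rcases (show #G' = 1 ∨ #G' = 2 ∨ 2 < #G' by omega) with h1 | h2 | h3
  · obtain ⟨f, hf⟩ := hne'
    have := card_add_three_le_of_meets_pair hG (hG' hf) fun e he => h e he f hf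
    omega
  · obtain ⟨f, g, hfg, rfl⟩ := card_eq_two.1 h2
    have := card_le_of_meets_two_pairs (by omega) hG (hG' (by simp : f ∈ _))
      (hG' (by simp : g ∈ _)) hfg (fun e he => h e he f (by simp))
      (fun e he => h e he g (by simp))
    omega
  · obtain ⟨f, hf, g, hg, k, hk, hfg, hfk, hgk⟩ := two_lt_card.1 h3
    have := card_lt_of_meets_three_pairs hK hG (hG' hf) (hG' hg) (hG' hk) hfg hfk hgk
      (fun e he => h e he f hf) (fun e he => h e he g hg) (fun e he => h e he k hk)
    omega

end CrossIntersecting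

/-- A sum of naturals with at least two nonzero terms is at most `m` times the number of terms
when any two nonzero terms sum to at most `2m`. -/
theorem sum_le_card_mul_of_pairwise_add_le {ι : Type*} [DecidableEq ι] (W : Finset ι) (w : ι → ℕ)
    (m : ℕ) (h : ∀ u ∈ W, ∀ v ∈ W, u ≠ v → w u ≠ 0 → w v ≠ 0 → w u + w v ≤ 2 * m)
    {u v : ι} (hu : u ∈ W) (hv : v ∈ W) (huv : u ≠ v) (hwu : w u ≠ 0) (hwv : w v ≠ 0) :
    ∑ z ∈ W, w z ≤ #W * m := by
  by_cases hall : ∀ z ∈ W, w z ≤ m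
  · simpa using sum_le_card_nsmul W w m hall
  push Not at hall
  obtain ⟨p, hp, hmp⟩ := hall
  obtain ⟨q, hq, hqp, hwq⟩ : ∃ q ∈ W, q ≠ p ∧ w q ≠ 0 := by
    by_cases hup : u = p
    · exact ⟨v, hv, fun hvp => huv (hup.trans hvp.symm), hwv⟩
    · exact ⟨u, hu, hup, hwu⟩
  have hqW : q ∈ W.erase p := mem_erase.2 ⟨hqp, hq⟩
  rw [← add_sum_erase W w hp, ← add_sum_erase _ w hqW]
  have hpq := h p hp q hq hqp.symm (by omega) hwq
  have hrest : ∑ z ∈ (W.erase p).erase q, w z ≤ #((W.erase p).erase q) * m := by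
    refine (sum_le_card_nsmul _ w m fun z hz => ?_).trans_eq (smul_eq_mul _ _)
    simp only [mem_erase] at hz
    by_contra! hlt
    have := h p hp z hz.2.2 (Ne.symm hz.2.1) (by omega) (by omega)
    omega
  have hc1 := card_erase_add_one hqW
  have hc2 := card_erase_add_one hp
  have : #W = #((W.erase p).erase q) + 2 := by omega
  rw [this, add_mul]
  omega

/-- An intersecting family of triples, each with exactly two vertices in `K`, which involves at
least two vertices outside `K` has at most `(#K - 1) * #Kᶜ` members. -/
theorem card_le_of_intersecting {α : Type*} [DecidableEq α] [Fintype α] {K : Finset α}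
    (hK : 5 ≤ #K) {F : Finset (Finset α)} (hF : ∀ e ∈ F, #e = 3) (hFK : ∀ e ∈ F, #(e ∩ K) = 2)
    (hint : ∀ e ∈ F, ∀ f ∈ F, ¬ Disjoint e f) {u v : α} (huK : u ∉ K) (hvK : v ∉ K)
    (huv : u ≠ v) (hu : ∃ e ∈ F, u ∈ e) (hv : ∃ e ∈ F, v ∈ e) :
    #F ≤ #Kᶜ * (#K - 1) := by
  have herase : ∀ z ∉ K, ∀ e ∈ F, z ∈ e → e.erase z = e ∩ K := by
    intro z hz e he hze
    refine (eq_of_subset_of_card_le ?_ ?_).symm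
    · intro y hy
      rw [mem_inter] at hy
      exact mem_erase.2 ⟨fun h => hz (h ▸ hy.2), hy.1⟩
    · rw [card_erase_of_mem hze, hF e he, hFK e he]
  have hlink : ∀ z ∉ K, #({e ∈ F | z ∈ e}.image (· ∩ K)) = #{e ∈ F | z ∈ e} := by
    intro z hz
    refine card_image_of_injOn fun e he f hf hef => ?_
    obtain ⟨heF, hze⟩ := mem_filter.1 he
    obtain ⟨hfF, hzf⟩ := mem_filter.1 hf
    rw [← insert_erase hze, ← insert_erase hzf, herase z hz e heF hze, herase z hz f hfF hzf]
    exact congrArg (insert z) hef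
  have hlinkK : ∀ z, {e ∈ F | z ∈ e}.image (· ∩ K) ⊆ powersetCard 2 K := by
    intro z f hf
    obtain ⟨e, he, rfl⟩ := mem_image.1 hf
    exact mem_powersetCard.2 ⟨inter_subset_right, hFK e (mem_filter.1 he).1⟩
  have hpair : ∀ p ∈ Kᶜ, ∀ q ∈ Kᶜ, p ≠ q → #{e ∈ F | p ∈ e} ≠ 0 → #{e ∈ F | q ∈ e} ≠ 0 →
      #{e ∈ F | p ∈ e} + #{e ∈ F | q ∈ e} ≤ 2 * (#K - 1) := by
    intro p hp q hq hpq hp0 hq0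
    rw [mem_compl] at hp hq
    have hcross := card_add_card_le_of_cross_intersecting hK (hlinkK p) (hlinkK q)
      ((card_ne_zero.1 hp0).image _) ((card_ne_zero.1 hq0).image _) (by
        intro e' he' f' hf' hdis
        obtain ⟨e, he, rfl⟩ := mem_image.1 he'
        obtain ⟨f, hf, rfl⟩ := mem_image.1 hf'
        obtain ⟨heF, hpe⟩ := mem_filter.1 he
        obtain ⟨hfF, hqf⟩ := mem_filter.1 hf
        apply hint e heF f hfF
        rw [← insert_erase hpe, ← insert_erase hqf, herase p hp e heF hpe,
          herase q hq f hfF hqf]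
        simp only [disjoint_insert_left, disjoint_insert_right, mem_insert, mem_inter, hp, hq,
          hdis, hpq.symm, and_false, or_false, not_false_eq_true, and_true])
    rw [hlink p hp, hlink q hq] at hcross
    omega
  have hsub : F ⊆ Kᶜ.biUnion fun z => {e ∈ F | z ∈ e} := by
    intro e he
    have : ¬ e ⊆ K := fun h => by
      have h1 := hFK e he
      rw [inter_eq_left.2 h, hF e he] at h1
      omega
    obtain ⟨z, hze, hzK⟩ := not_subset.1 this
    exact mem_biUnion.2 ⟨z, mem_compl.2 hzK, mem_filter.2 ⟨he, hze⟩⟩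
  have hpos : ∀ z, (∃ e ∈ F, z ∈ e) → #{e ∈ F | z ∈ e} ≠ 0 := fun z ⟨e, he, hz⟩ =>
    card_ne_zero_of_mem (mem_filter.2 ⟨he, hz⟩)
  exact ((card_le_card hsub).trans card_biUnion_le).trans
    (sum_le_card_mul_of_pairwise_add_le Kᶜ (fun z => #{e ∈ F | z ∈ e}) (#K - 1) hpair
      (mem_compl.2 huK) (mem_compl.2 hvK) huv (hpos u hu) (hpos v hv))

theorem choose_three_add_mul_choose_two_le (k j : ℕ) :
    k.choose 3 + j * k.choose 2 ≤ (k + j).choose 3 := by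
  induction j with
  | zero => simp
  | succ j ih =>
    have h1 : (k + (j + 1)).choose 3 = (k + j).choose 2 + (k + j).choose 3 :=
      Nat.choose_succ_succ (k + j) 2
    have h2 := Nat.choose_le_choose 2 (Nat.le_add_right k j)
    rw [h1, add_mul]
    omega

/-- The version of the stability theorem with the numerical hypotheses made explicit. -/
theorem exists_card_eq_forall_subset {α : Type*} [DecidableEq α] [Fintype α] {s : ℕ} (hs : 2 ≤ s)
    (hsα : 3 * s + 2 ≤ Fintype.card α) {H : Finset (Finset α)} (hH : ∀ e ∈ H, #e = 3)
    {K : Finset α} (hK : powersetCard 3 K ⊆ H) (hν : ∀ M ⊆ H, IsMatchingFam M → #M ≤ s) {d : ℕ}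
    (hd : 3 * s + 2 ≤ #K + d)
    (hnum : 2 * (Fintype.card α).choose 2 + 18 * (d + 1) * Fintype.card α ≤ 3 * (#K).choose 2)
    (hcard : (3 * s + 1).choose 3 + 3 * s * (Fintype.card α - 3 * s - 1) < #H) :
    ∃ U : Finset α, #U = 3 * s + 2 ∧ ∀ e ∈ H, e ⊆ U := by
  set D := 3 * (d + 1) * Fintype.card α with hD
  have hKs : #K ≤ 3 * s + 2 := by
    by_contra! hlt
    obtain ⟨M, hM, hMm, hMc⟩ := exists_disjoint_triples (s + 1) K (by omega)
    have := hν M (hM.trans hK) hMm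
    omega
  set R := {r ∈ Kᶜ | D < #{e ∈ H | r ∈ e}}
  have hKR : Disjoint K R := disjoint_compl_right.mono_right (filter_subset _ _)
  have hRs : #K + #R ≤ 3 * s + 2 := by
    by_contra! hlt
    obtain ⟨R', hR', hR'c⟩ := exists_subset_card_eq (show 3 * s + 3 - #K ≤ #R by omega)
    have hKR' := card_union_of_disjoint (hKR.mono_right hR')
    obtain ⟨M, hM, hMm, hMc⟩ := exists_matching_extension hH hK (R := R') (empty_subset H)
      (by simp [IsMatchingFam]) (t := s + 1)
      (fun r hr => (Nat.mul_le_mul_right _ (by rw [card_empty]; omega)).trans_lt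
        (mem_filter.1 (hR' hr)).2)
      (by rw [biUnion_empty, empty_inter, card_empty]; omega)
    have := hν M hM hMm
    rw [card_empty] at hMc
    omega
  set L := K ∪ R with hL
  have hLc : #L = #K + #R := card_union_of_disjoint hKR
  have hext : ∀ M ⊆ H, IsMatchingFam M → #L + #M ≤ 3 * s + 3 →
      #(M.biUnion id ∩ L) + 3 * (s + 1) ≤ #L + 3 * #M → #M = 0 := by
    intro M hM hMm hMc hML
    by_contra h0
    obtain ⟨M', hM', hM'm, hM'c⟩ := exists_matching_extension hH hK (R := R) hM hMm
      (t := s + 1 - #M)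
      (fun r hr => (Nat.mul_le_mul_right _ (by omega)).trans_lt (mem_filter.1 hr).2)
      (by have := hν M hM hMm; rw [← hL]; omega)
    have := hν M' hM' hM'm
    omega
  set F := {e ∈ H | ¬ e ⊆ L}
  have hFH : F ⊆ H := filter_subset _ _
  have hF3 : ∀ e ∈ F, #e = 3 := fun e he => hH e (hFH he)
  have hFL : ∀ e ∈ F, ¬ e ⊆ L := fun e he => (mem_filter.1 he).2
  have hFL2 : ∀ e ∈ F, #(e ∩ L) ≤ 2 := by
    intro e he
    have := card_lt_card (inter_subset_left.ssubset_of_ne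
      fun h => hFL e he (inter_eq_left.1 h))
    have := hF3 e he
    omega
  have hinter : ∀ M ⊆ F, #(M.biUnion id ∩ L) ≤ 2 * #M := by
    intro M hM
    rw [biUnion_inter, mul_comm]
    exact card_biUnion_le_card_mul _ _ _ fun e he => hFL2 e (hM he)
  have hFd : ∀ M ⊆ F, IsMatchingFam M → #M ≤ 3 * s + 2 - #L := by
    intro M hM hMm
    by_contra! hlt
    obtain ⟨M', hM', hM'c⟩ := exists_subset_card_eq (show 3 * s + 3 - #L ≤ #M by omega)
    have h1 := hinter M' (hM'.trans hM)
    have := hext M' ((hM'.trans hM).trans hFH) (hMm.mono (coe_subset.2 hM')) (by omega) (by omega)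
    omega
  have hHF : #H ≤ (#L).choose 3 + #F := by
    rw [← card_filter_add_card_filter_not (s := H) (fun e => e ⊆ L), ← card_powersetCard]
    refine Nat.add_le_add_right (card_le_card fun e he => ?_) _
    obtain ⟨heH, heL⟩ := mem_filter.1 he
    exact mem_powersetCard.2 ⟨heL, hH e heH⟩
  rcases (show #L = 3 * s + 2 ∨ #L = 3 * s + 1 ∨ #L ≤ 3 * s by omega) with h0 | h1 | h2
  · refine ⟨L, h0, fun e he => ?_⟩
    by_contra heL
    have := hFd {e} (singleton_subset_iff.2 (mem_filter.2 ⟨he, heL⟩)) (isMatchingFam_singleton e)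
    rw [card_singleton] at this
    omega
  · obtain ⟨v₀, hv₀⟩ : ∃ v, v ∉ L := by
      by_contra! hall
      rw [eq_univ_iff_forall.2 hall, card_univ] at h1
      omega
    by_cases hFe : ∃ v ∉ L, ∀ e ∈ H, e ⊆ insert v L
    · obtain ⟨v, hv, hvH⟩ := hFe
      exact ⟨insert v L, by rw [card_insert_of_notMem hv, h1], hvH⟩
    exfalso
    push Not at hFe
    have hpick : ∀ v ∉ L, ∃ u ∉ L, u ≠ v ∧ ∃ e ∈ F, u ∈ e := by
      intro v hv
      obtain ⟨e, he, hev⟩ := hFe v hv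
      obtain ⟨u, hue, huv⟩ := not_subset.1 hev
      rw [mem_insert, not_or] at huv
      exact ⟨u, huv.2, huv.1, e, mem_filter.2 ⟨he, fun h => huv.2 (h hue)⟩, hue⟩
    obtain ⟨u, huL, -, hu⟩ := hpick v₀ hv₀
    obtain ⟨v, hvL, hvu, hv⟩ := hpick u huL
    have hbound := card_le_of_intersecting (K := L) (by omega) hF3 (fun e he => ?_)
      (fun e he f hf hdis => ?_) huL hvL hvu.symm hu hv
    · rw [card_compl, h1, Nat.add_sub_cancel, mul_comm, ← Nat.sub_sub] at hbound
      rw [h1] at hHF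
      omega
    · by_contra hne
      have := hFL2 e he
      have := hext {e} (singleton_subset_iff.2 (hFH he)) (isMatchingFam_singleton e)
        (by rw [card_singleton]; omega)
        (by rw [singleton_biUnion, card_singleton, id]; omega)
      simp at this
    · have hef : e ≠ f := by
        rintro rfl
        rw [disjoint_self, bot_eq_empty] at hdis
        have := hF3 e he
        simp [hdis] at this
      have := hFd {e, f} (insert_subset he (singleton_subset_iff.2 hf)) (by
        intro a ha b hb hab
        simp only [coe_insert, coe_singleton, Set.mem_insert_iff, Set.mem_singleton_iff] at ha hb
        rcases ha with rfl | rfl <;> rcases hb with rfl | rfl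
        · exact absurd rfl hab
        · exact hdis
        · exact hdis.symm
        · exact absurd rfl hab)
      rw [card_pair hef] at this
      omega
  · exfalso
    have hout : ∀ z ∉ L, #{e ∈ F | z ∈ e} ≤ D := by
      intro z hz
      rw [hL, mem_union, not_or] at hz
      have hzD : #{e ∈ H | z ∈ e} ≤ D := by
        by_contra! hlt
        exact hz.2 (mem_filter.2 ⟨mem_compl.2 hz.1, hlt⟩)
      exact (card_le_card (filter_subset_filter _ hFH)).trans hzD
    have hFc := card_le_of_matching_le hF3 hFL (D := D) (Nat.mul_le_mul_right _ (by omega)) hout hFd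
    have hKL : (#K).choose 2 ≤ (#L).choose 2 := Nat.choose_le_choose 2 (by omega)
    obtain ⟨j, hj⟩ : ∃ j, 3 * s + 2 - #L = j + 2 := ⟨3 * s - #L, by omega⟩
    have hchoose := choose_three_add_mul_choose_two_le #L (j + 1)
    rw [show #L + (j + 1) = 3 * s + 1 by omega] at hchoose
    rw [hj] at hFc
    set X := 3 * D + ((Fintype.card α).choose 2 - (#L).choose 2)
    have hX : 2 * X ≤ (#L).choose 2 := by
      have hD6 : 18 * (d + 1) * Fintype.card α = 6 * D := by rw [hD]; ring
      have hLn : (#L).choose 2 ≤ (Fintype.card α).choose 2 :=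
        Nat.choose_le_choose 2 (card_le_univ L)
      omega
    have : (j + 2) * X ≤ (j + 1) * (#L).choose 2 := by nlinarith
    omega

/-- If a 3-graph `H` on `n` vertices with `5n/18 - 1 ≤ s ≤ (n-2)/3` has a clique on at least
`(1-ε)·3s` vertices, matching number at most `s` and more than `binom(3s+1,3) + 3s(n-3s-1)`
edges, then `H` is a subgraph of `D³_{n,s}`. -/
theorem stability_with_large_clique :
    ∃ ε : ℝ, 0 < ε ∧ ∃ n0 : ℕ, 0 < n0 ∧ ∀ n s : ℕ, n0 < n →
      5 * (n : ℝ) / 18 - 1 ≤ (s : ℝ) → (s : ℝ) ≤ ((n : ℝ) - 2) / 3 →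
      ∀ H ⊆ completeEdges n 3,
        (∃ U : Finset (Fin n), Finset.powersetCard 3 U ⊆ H ∧
          (1 - ε) * (3 * (s : ℝ)) ≤ (U.card : ℝ)) →
        (∀ M ⊆ H, IsMatchingFam M → M.card ≤ s) →
        (3 * s + 1).choose 3 + 3 * s * (n - 3 * s - 1) < H.card →
        ∃ U : Finset (Fin n), U.card = 3 * s + 2 ∧ ∀ e ∈ H, e ⊆ U := by
  refine ⟨1 / 1000, by norm_num, 10000, by norm_num, ?_⟩
  rintro n s hn hs1 hs2 H hH ⟨K, hK, hKc⟩ hν hcard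
  have hnR : (10000 : ℝ) < n := by exact_mod_cast hn
  have hsn : 3 * s + 2 ≤ n := by
    have : (3 * s + 2 : ℝ) ≤ n := by linarith
    exact_mod_cast this
  have hs : 2 ≤ s := by
    have : (2 : ℝ) ≤ s := by linarith
    exact_mod_cast this
  refine exists_card_eq_forall_subset (d := 3 * s + 2 - #K) hs (by simpa using hsn)
    (fun e he => (mem_powersetCard.1 (hH he)).2) hK hν (by omega) ?_ (by simpa using hcard)
  rw [Fintype.card_fin]
  have hd : ((3 * s + 2 - #K : ℕ) : ℝ) ≤ n / 1000 + 2 := by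
    rcases le_total #K (3 * s + 2) with h | h
    · rw [Nat.cast_sub h]
      push_cast
      linarith
    · rw [Nat.sub_eq_zero_of_le h, Nat.cast_zero]
      linarith
  have hk : (8325 / 10000 : ℝ) * n - 3 ≤ #K := by linarith
  suffices h : (2 * n.choose 2 + 18 * (3 * s + 2 - #K + 1 : ℕ) * n : ℝ) ≤
      3 * (#K).choose 2 by exact_mod_cast h
  rw [Nat.cast_choose_two, Nat.cast_choose_two]
  push_cast [Nat.cast_add]
  have h1 := mul_le_mul_of_nonneg_right hd (Nat.cast_nonneg (α := ℝ) n)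
  have h2 : ((8325 / 10000 : ℝ) * n - 3) * (8325 / 10000 * n - 4) ≤ #K * (#K - 1 : ℝ) :=
    mul_le_mul hk (by linarith) (by linarith) (by linarith)
  nlinarith
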